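/- arXiv:1005.0422 — 3 statements merged into one kernel-verified Lean document; each statement's English description precedes it below -/
import Mathlib

section
/- Let $A$ be a connected algebraic ring over an algebraically closed field $K$ (i.e., the underlying variety of $A$ is connected). Then every element of $A$ is a difference of two units: $A = A^{\times} - A^{\times}$. -/
noncomputable section

open MvPolynomial

/-- The Zariski topology on affine `n`-space over `K`. -/
def affineZariski (K : Type) [Field K] (n : ℕ) : TopologicalSpace (Fin n → K) :=
  TopologicalSpace.generateFrom
    {U | ∃ p : MvPolynomial (Fin n) K, U = {x | MvPolynomial.eval x p ≠ 0}}

/-- An algebraic ring over `K`: a Zariski-closed subset of some affine space `K^n`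
equipped with regular (polynomial) addition, negation and multiplication maps making it
into a unital ring whose additive group is a commutative algebraic group. -/
structure AlgebraicRing (K : Type) [Field K] where
  n : ℕ
  carrier : Set (Fin n → K)
  carrier_closed : ∃ S : Set (MvPolynomial (Fin n) K),
    carrier = {x | ∀ p ∈ S, MvPolynomial.eval x p = 0}
  add : (Fin n → K) → (Fin n → K) → Fin n → K
  mul : (Fin n → K) → (Fin n → K) → Fin n → K
  neg : (Fin n → K) → Fin n → K
  zero : Fin n → K
  one : Fin n → K
  add_poly : ∃ P : Fin n → MvPolynomial (Fin n ⊕ Fin n) K,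
    ∀ x y : Fin n → K, ∀ i, add x y i = MvPolynomial.eval (Sum.elim x y) (P i)
  mul_poly : ∃ P : Fin n → MvPolynomial (Fin n ⊕ Fin n) K,
    ∀ x y : Fin n → K, ∀ i, mul x y i = MvPolynomial.eval (Sum.elim x y) (P i)
  neg_poly : ∃ P : Fin n → MvPolynomial (Fin n) K,
    ∀ x : Fin n → K, ∀ i, neg x i = MvPolynomial.eval x (P i)
  zero_mem : zero ∈ carrier
  one_mem : one ∈ carrier
  add_mem : ∀ {x y}, x ∈ carrier → y ∈ carrier → add x y ∈ carrier
  mul_mem : ∀ {x y}, x ∈ carrier → y ∈ carrier → mul x y ∈ carrier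
  neg_mem : ∀ {x}, x ∈ carrier → neg x ∈ carrier
  add_comm' : ∀ x ∈ carrier, ∀ y ∈ carrier, add x y = add y x
  add_assoc' : ∀ x ∈ carrier, ∀ y ∈ carrier, ∀ z ∈ carrier,
    add (add x y) z = add x (add y z)
  zero_add' : ∀ x ∈ carrier, add zero x = x
  neg_add_cancel' : ∀ x ∈ carrier, add (neg x) x = zero
  mul_assoc' : ∀ x ∈ carrier, ∀ y ∈ carrier, ∀ z ∈ carrier,
    mul (mul x y) z = mul x (mul y z)
  one_mul' : ∀ x ∈ carrier, mul one x = x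
  mul_one' : ∀ x ∈ carrier, mul x one = x
  left_distrib' : ∀ x ∈ carrier, ∀ y ∈ carrier, ∀ z ∈ carrier,
    mul x (add y z) = add (mul x y) (mul x z)
  right_distrib' : ∀ x ∈ carrier, ∀ y ∈ carrier, ∀ z ∈ carrier,
    mul (add x y) z = add (mul x z) (mul y z)

namespace AlgebraicRing

variable {K : Type} [Field K] (A : AlgebraicRing K)

/-- The points of the algebraic ring `A`. -/
def Elt : Type := {x : Fin A.n → K // x ∈ A.carrier}

instance : TopologicalSpace A.Elt :=
  TopologicalSpace.induced (fun x => x.1) (affineZariski K A.n)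

instance : Add A.Elt := ⟨fun x y => ⟨A.add x.1 y.1, A.add_mem x.2 y.2⟩⟩
instance : Mul A.Elt := ⟨fun x y => ⟨A.mul x.1 y.1, A.mul_mem x.2 y.2⟩⟩
instance : Neg A.Elt := ⟨fun x => ⟨A.neg x.1, A.neg_mem x.2⟩⟩
instance : Zero A.Elt := ⟨⟨A.zero, A.zero_mem⟩⟩
instance : One A.Elt := ⟨⟨A.one, A.one_mem⟩⟩

instance : AddCommGroup A.Elt where
  add_assoc a b c := Subtype.ext (A.add_assoc' _ a.2 _ b.2 _ c.2)
  zero_add a := Subtype.ext (A.zero_add' _ a.2)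
  add_zero a := Subtype.ext (by
    show A.add a.1 A.zero = a.1
    rw [A.add_comm' _ a.2 _ A.zero_mem]
    exact A.zero_add' _ a.2)
  neg_add_cancel a := Subtype.ext (A.neg_add_cancel' _ a.2)
  add_comm a b := Subtype.ext (A.add_comm' _ a.2 _ b.2)
  nsmul := nsmulRec
  zsmul := zsmulRec

instance : Ring A.Elt :=
  { (inferInstance : AddCommGroup A.Elt) with
    left_distrib := fun a b c => Subtype.ext (A.left_distrib' _ a.2 _ b.2 _ c.2)
    right_distrib := fun a b c => Subtype.ext (A.right_distrib' _ a.2 _ b.2 _ c.2)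
    zero_mul := fun a => by
      have h : (0 : A.Elt) * a + (0 : A.Elt) * a = (0 : A.Elt) * a + 0 := by
        rw [add_zero]
        apply Subtype.ext
        show A.add (A.mul A.zero a.1) (A.mul A.zero a.1) = A.mul A.zero a.1
        rw [← A.right_distrib' _ A.zero_mem _ A.zero_mem _ a.2, A.zero_add' _ A.zero_mem]
      exact add_left_cancel h
    mul_zero := fun a => by
      have h : a * (0 : A.Elt) + a * (0 : A.Elt) = a * (0 : A.Elt) + 0 := by
        rw [add_zero]
        apply Subtype.ext
        show A.add (A.mul a.1 A.zero) (A.mul a.1 A.zero) = A.mul a.1 A.zero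
        rw [← A.left_distrib' _ a.2 _ A.zero_mem _ A.zero_mem, A.zero_add' _ A.zero_mem]
      exact add_left_cancel h
    mul_assoc := fun a b c => Subtype.ext (A.mul_assoc' _ a.2 _ b.2 _ c.2)
    one_mul := fun a => Subtype.ext (A.one_mul' _ a.2)
    mul_one := fun a => Subtype.ext (A.mul_one' _ a.2) }

end AlgebraicRing

/-- A commutative algebraic ring. -/
structure CommAlgebraicRing (K : Type) [Field K] extends AlgebraicRing K where
  mul_comm' : ∀ x ∈ carrier, ∀ y ∈ carrier, mul x y = mul y x

namespace CommAlgebraicRing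

variable {K : Type} [Field K] (A : CommAlgebraicRing K)

/-- The points of the commutative algebraic ring `A`. -/
abbrev Elt : Type := A.toAlgebraicRing.Elt

instance : CommRing A.Elt :=
  { (inferInstance : Ring A.toAlgebraicRing.Elt) with
    mul_comm := fun a b => Subtype.ext (by exact A.mul_comm' _ a.2 _ b.2) }

end CommAlgebraicRing

end


open MvPolynomial

open Topology in
theorem mem_nhds_of_constructible {X : Type*} [TopologicalSpace X] (η : X)
    (hη : ∀ U : Set X, IsOpen U → U.Nonempty → η ∈ U) (s : Set X) (hs : IsConstructible s) :
    (η ∈ s → s ∈ 𝓝 η) ∧ (η ∉ s → sᶜ ∈ 𝓝 η) := by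
  induction hs using IsConstructible.empty_union_induction with
  | open_retrocompact U hU _ =>
    refine ⟨fun h => hU.mem_nhds h, fun h => ?_⟩
    have : U = ∅ := by
      by_contra hne
      exact h (hη U hU (Set.nonempty_iff_ne_empty.2 hne))
    simp [this]
  | union s hs t ht ihs iht =>
    refine ⟨?_, ?_⟩
    · rintro (h | h)
      · exact Filter.mem_of_superset (ihs.1 h) Set.subset_union_left
      · exact Filter.mem_of_superset (iht.1 h) Set.subset_union_right
    · intro h
      rw [Set.compl_union]
      exact Filter.inter_mem (ihs.2 fun h' => h (Or.inl h')) (iht.2 fun h' => h (Or.inr h'))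
  | compl s hs ih =>
    refine ⟨ih.2, fun h => ?_⟩
    rw [compl_compl]
    exact ih.1 (by simpa using h)

/-- Generic surjectivity on spectra. -/
theorem exists_basicOpen_subset_range {R : Type*} [CommRing R] [IsDomain R]
    (f : R →+* R) (hf : f.FinitePresentation) (hinj : Function.Injective f) :
    ∃ g : R, g ≠ 0 ∧ ∀ P : PrimeSpectrum R, g ∉ P.asIdeal →
      ∃ Q : PrimeSpectrum R, Q.asIdeal.comap f = P.asIdeal := by
  let η : PrimeSpectrum R := ⟨⊥, Ideal.isPrime_bot⟩
  have hη : ∀ U : Set (PrimeSpectrum R), IsOpen U → U.Nonempty → η ∈ U := by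
    rintro U hU ⟨P, hP⟩
    obtain ⟨_, ⟨g, rfl⟩, h1, h2⟩ :=
      PrimeSpectrum.isTopologicalBasis_basic_opens.exists_subset_of_mem_open hP hU
    apply h2
    show g ∉ (⊥ : Ideal R)
    intro h
    rw [Ideal.mem_bot] at h
    apply h1
    rw [h]; exact P.asIdeal.zero_mem
  have hr : η ∈ Set.range (PrimeSpectrum.comap f) := by
    refine ⟨η, PrimeSpectrum.ext ?_⟩
    show Ideal.comap f ⊥ = ⊥
    exact (RingHom.injective_iff_ker_eq_bot f).1 hinj
  have := (mem_nhds_of_constructible η hη _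
    (PrimeSpectrum.isConstructible_range_comap hf)).1 hr
  obtain ⟨_, ⟨g, rfl⟩, h1, h2⟩ :=
    PrimeSpectrum.isTopologicalBasis_basic_opens.mem_nhds_iff.1 this
  refine ⟨g, fun h => h1 (by simp [h]), fun P hP => ?_⟩
  obtain ⟨Q, hQ⟩ := h2 (show P ∈ _ from hP)
  exact ⟨Q, by rw [← hQ]; rfl⟩

theorem ringEndo_injective_of_surjective {R : Type*} [CommRing R] [IsNoetherianRing R]
    (f : R →+* R) (hf : Function.Surjective f) : Function.Injective f := by
  have hsurj : ∀ n : ℕ, Function.Surjective (f ^ n : R →+* R) := fun n => by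
    rw [RingHom.coe_pow]; exact hf.iterate n
  let c : ℕ →o Ideal R := ⟨fun n => RingHom.ker (f ^ n : R →+* R), by
    refine monotone_nat_of_le_succ fun n x hx => ?_
    rw [RingHom.mem_ker] at *
    rw [pow_succ', RingHom.mul_def, RingHom.comp_apply, hx, map_zero]⟩
  obtain ⟨n, hn⟩ := monotone_stabilizes_iff_noetherian.2 ‹IsNoetherianRing R› c
  rw [injective_iff_map_eq_zero]
  intro a ha
  obtain ⟨b, rfl⟩ := hsurj n a
  have h1 : b ∈ c (n + 1) := by
    show b ∈ RingHom.ker _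
    rw [RingHom.mem_ker, pow_succ', RingHom.mul_def, RingHom.comp_apply, ha]
  rw [← hn (n + 1) (Nat.le_succ n)] at h1
  exact h1

theorem injective_of_cotangent {R : Type*} [CommRing R] [IsNoetherianRing R] [IsDomain R]
    (m : Ideal R) (hm : m ≠ ⊤) (f : R →+* R) (h0 : ∀ a ∈ m, f a ∈ m)
    (h1 : ∀ a, ∃ b, a - f b ∈ m) (h2 : ∀ a ∈ m, ∃ b ∈ m, a - f b ∈ m ^ 2) :
    Function.Injective f := by
  have hmap : m.map f ≤ m := Ideal.map_le_iff_le_comap.2 h0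
  have hpow : ∀ k, ∀ a ∈ m ^ k, f a ∈ m ^ k := fun k a ha => by
    have := Ideal.mem_map_of_mem f ha
    rw [Ideal.map_pow] at this
    exact Ideal.pow_right_mono hmap k this
  have h3 : ∀ k, ∀ a ∈ m ^ (k + 1), ∃ b ∈ m ^ (k + 1), a - f b ∈ m ^ (k + 2) := by
    intro k
    induction k with
    | zero => simpa using h2
    | succ k ih =>
      intro a ha
      rw [pow_succ] at ha
      induction ha using Submodule.mul_induction_on' with
      | mem_mul_mem x hx y hy =>
        obtain ⟨b, hb, hb'⟩ := ih x hx
        obtain ⟨c, hc, hc'⟩ := h2 y hy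
        refine ⟨b * c, by rw [pow_succ]; exact Ideal.mul_mem_mul hb hc, ?_⟩
        have e : x * y - f (b * c) = (x - f b) * y + f b * (y - f c) := by
          rw [map_mul]; ring
        rw [e]
        refine add_mem ?_ ?_
        · rw [show k + 1 + 2 = (k + 2) + 1 by ring, pow_succ]
          exact Ideal.mul_mem_mul hb' hy
        · rw [pow_add m (k + 1) 2]
          exact Ideal.mul_mem_mul (hpow _ _ hb) hc'
      | add x hx y hy ihx ihy =>
        obtain ⟨b, hb, hb'⟩ := ihx
        obtain ⟨c, hc, hc'⟩ := ihy
        refine ⟨b + c, add_mem hb hc, ?_⟩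
        have e : x + y - f (b + c) = (x - f b) + (y - f c) := by rw [map_add]; ring
        rw [e]; exact add_mem hb' hc'
  have h4 : ∀ k, ∀ a, ∃ b, a - f b ∈ m ^ (k + 1) := by
    intro k
    induction k with
    | zero => simpa using h1
    | succ k ih =>
      intro a
      obtain ⟨b, hb⟩ := ih a
      obtain ⟨c, _, hc⟩ := h3 k _ hb
      exact ⟨b + c, by rw [map_add, ← sub_sub]; exact hc⟩
  rw [injective_iff_map_eq_zero]
  intro a ha
  have h5 : ∀ k, a ∈ m ^ (k + 1) := by
    intro k
    have hle : m ^ (k + 1) ≤ (m ^ (k + 1)).comap f := fun x hx => hpow _ x hx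
    let g : R ⧸ m ^ (k + 1) →+* R ⧸ m ^ (k + 1) :=
      Ideal.quotientMap _ f hle
    have hgm : ∀ b, g (Ideal.Quotient.mk _ b) = Ideal.Quotient.mk _ (f b) := fun _ => rfl
    have hg : Function.Surjective g := by
      intro y
      obtain ⟨y, rfl⟩ := Ideal.Quotient.mk_surjective y
      obtain ⟨b, hb⟩ := h4 k y
      refine ⟨Ideal.Quotient.mk _ b, ?_⟩
      rw [hgm]
      exact (Ideal.Quotient.eq.2 hb).symm
    have := (injective_iff_map_eq_zero g).1 (ringEndo_injective_of_surjective g hg)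
      (Ideal.Quotient.mk _ a) (by rw [hgm, ha, map_zero])
    exact Ideal.Quotient.eq_zero_iff_mem.1 this
  have h6 : a ∈ (⨅ i : ℕ, m ^ i) := by
    rw [Ideal.mem_iInf]
    intro i
    exact Ideal.pow_le_pow_right (Nat.le_succ i) (h5 i)
  rwa [Ideal.iInf_pow_eq_bot_of_isDomain m hm] at h6

/-- First order Taylor expansion. -/
theorem taylor_one {K : Type*} [Field K] {n : ℕ} {R : Type*} [CommRing R] [Algebra K R]
    (ev : MvPolynomial (Fin n) K →ₐ[K] R) (z : Fin n → K) (m : Ideal R)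
    (hm : ∀ i, ev (X i) - algebraMap K R (z i) ∈ m) (p : MvPolynomial (Fin n) K) :
    ev p - algebraMap K R (eval z p)
      - ∑ j, algebraMap K R (eval z (pderiv j p)) * (ev (X j) - algebraMap K R (z j)) ∈ m ^ 2 := by
  induction p using MvPolynomial.induction_on with
  | C a =>
    have : ev (C a) = algebraMap K R a := ev.commutes a
    simp [this]
  | add p q hp hq =>
    convert add_mem hp hq using 1
    simp only [map_add, add_mul, Finset.sum_add_distrib]
    ring
  | mul_X p i hp =>
    have e1 : ev (p * X i) - algebraMap K R (eval z (p * X i))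
      - ∑ j, algebraMap K R (eval z (pderiv j (p * X i))) * (ev (X j) - algebraMap K R (z j))
      = (ev p - algebraMap K R (eval z p)
      - ∑ j, algebraMap K R (eval z (pderiv j p)) * (ev (X j) - algebraMap K R (z j))) * ev (X i)
      + (∑ j, algebraMap K R (eval z (pderiv j p)) * (ev (X j) - algebraMap K R (z j))) *
        (ev (X i) - algebraMap K R (z i)) := by
      simp only [pderiv_mul, pderiv_X, map_add, map_mul, eval_X, add_mul, Finset.sum_add_distrib]
      have e2 : ∑ j, algebraMap K R (eval z p) *
          algebraMap K R (eval z ((Pi.single j 1 : Fin n → MvPolynomial (Fin n) K) i)) *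
          (ev (X j) - algebraMap K R (z j)) =
          algebraMap K R (eval z p) * (ev (X i) - algebraMap K R (z i)) := by
        rw [Finset.sum_eq_single i]
        · simp
        · intro b _ hb
          simp [hb.symm]
        · simp
      have e3 : ∑ j, algebraMap K R (eval z (pderiv j p)) * algebraMap K R (z i) *
          (ev (X j) - algebraMap K R (z j)) = (∑ j, algebraMap K R (eval z (pderiv j p)) *
          (ev (X j) - algebraMap K R (z j))) * algebraMap K R (z i) := by
        rw [Finset.sum_mul]
        exact Finset.sum_congr rfl fun _ _ => by ring
      rw [e2, e3]
      ring
    rw [e1]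
    refine add_mem (Ideal.mul_mem_right _ _ hp) ?_
    rw [pow_two]
    refine Ideal.mul_mem_mul (Ideal.sum_mem _ fun j _ => Ideal.mul_mem_left _ _ (hm j)) (hm i)

namespace AlgebraicRing

variable {K : Type} [Field K] (A : AlgebraicRing K)

/-- Evaluation of polynomials as functions on `A`. -/
noncomputable def evF : MvPolynomial (Fin A.n) K →ₐ[K] (A.Elt → K) :=
  aeval (fun i (a : A.Elt) => a.1 i)

theorem evF_apply (p : MvPolynomial (Fin A.n) K) (a : A.Elt) : A.evF p a = eval a.1 p := by
  induction p using MvPolynomial.induction_on with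
  | C c => simp [evF]
  | add p q hp hq => rw [map_add, map_add, Pi.add_apply, hp, hq]
  | mul_X p i hp => rw [map_mul, map_mul, Pi.mul_apply, hp]; simp [evF]

/-- The coordinate ring. -/
noncomputable abbrev Coord : Subalgebra K (A.Elt → K) := A.evF.range

/-- Polynomials onto the coordinate ring. -/
noncomputable def ev : MvPolynomial (Fin A.n) K →ₐ[K] A.Coord := A.evF.rangeRestrict

theorem ev_surj : Function.Surjective A.ev := A.evF.rangeRestrict_surjective

theorem ev_apply (p : MvPolynomial (Fin A.n) K) (a : A.Elt) : (A.ev p).1 a = eval a.1 p :=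
  A.evF_apply p a

instance : IsNoetherianRing A.Coord :=
  isNoetherianRing_of_surjective _ _ A.ev.toRingHom A.ev_surj

/-- Polynomial self-maps. -/
def IsPolyMap (f : A.Elt → A.Elt) : Prop :=
  ∃ F : Fin A.n → MvPolynomial (Fin A.n) K, ∀ a i, (f a).1 i = eval a.1 (F i)

variable {A}

theorem isOpen_ne (p : MvPolynomial (Fin A.n) K) : IsOpen {a : A.Elt | eval a.1 p ≠ 0} :=
  ⟨{x | eval x p ≠ 0}, TopologicalSpace.isOpen_generateFrom_of_mem ⟨p, rfl⟩, rfl⟩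

theorem eval_polyMap {f : A.Elt → A.Elt} {F : Fin A.n → MvPolynomial (Fin A.n) K}
    (hF : ∀ a i, (f a).1 i = eval a.1 (F i)) (p : MvPolynomial (Fin A.n) K) (a : A.Elt) :
    eval (f a).1 p = eval a.1 (bind₁ F p) := by
  have : (f a).1 = fun i => eval a.1 (F i) := funext (hF a)
  rw [this]
  induction p using MvPolynomial.induction_on with
  | C c => simp
  | add p q hp hq => simp only [map_add, hp, hq]
  | mul_X p i hp => simp only [map_mul, hp, eval_X, bind₁_X_right]

theorem IsPolyMap.continuous {f : A.Elt → A.Elt} (hf : A.IsPolyMap f) : Continuous f := by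
  obtain ⟨F, hF⟩ := hf
  refine continuous_induced_rng.2 (continuous_generateFrom_iff.2 ?_)
  rintro _ ⟨p, rfl⟩
  convert isOpen_ne (A := A) (bind₁ F p) using 1
  ext a
  simp only [Set.mem_preimage, Set.mem_ofPred_eq, Function.comp]
  rw [← eval_polyMap hF]

/-- Pullback of functions. -/
noncomputable def IsPolyMap.pull {f : A.Elt → A.Elt} (hf : A.IsPolyMap f) :
    A.Coord →ₐ[K] A.Coord where
  toFun g := ⟨fun a => g.1 (f a), by
    obtain ⟨F, hF⟩ := hf
    obtain ⟨p, hp⟩ := A.ev_surj g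
    refine ⟨bind₁ F p, funext fun a => ?_⟩
    subst hp
    show A.evF _ a = _
    rw [evF_apply, ev_apply, eval_polyMap hF]⟩
  map_one' := rfl
  map_mul' _ _ := rfl
  map_zero' := rfl
  map_add' _ _ := rfl
  commutes' _ := rfl

theorem IsPolyMap.pull_apply {f : A.Elt → A.Elt} (hf : A.IsPolyMap f) (g : A.Coord) (a : A.Elt) :
    (hf.pull g).1 a = g.1 (f a) := rfl

/-- Slicing a two-variable polynomial. -/
noncomputable def slice {K : Type} [Field K] {n : ℕ} (x : Fin n → K) :
    MvPolynomial (Fin n ⊕ Fin n) K →ₐ[K] MvPolynomial (Fin n) K :=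
  aeval (Sum.elim (fun i => C (x i)) X)

/-- Slicing in the other variable. -/
noncomputable def sliceR {K : Type} [Field K] {n : ℕ} (y : Fin n → K) :
    MvPolynomial (Fin n ⊕ Fin n) K →ₐ[K] MvPolynomial (Fin n) K :=
  aeval (Sum.elim X (fun i => C (y i)))

theorem eval_slice {n : ℕ} (x y : Fin n → K) (p : MvPolynomial (Fin n ⊕ Fin n) K) :
    eval y (slice x p) = eval (Sum.elim x y) p := by
  induction p using MvPolynomial.induction_on with
  | C c => simp [slice]
  | add p q hp hq => simp only [map_add, hp, hq]
  | mul_X p i hp => rw [map_mul, map_mul, hp]; rcases i with i | i <;> simp [slice]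

theorem eval_sliceR {n : ℕ} (x y : Fin n → K) (p : MvPolynomial (Fin n ⊕ Fin n) K) :
    eval x (sliceR y p) = eval (Sum.elim x y) p := by
  induction p using MvPolynomial.induction_on with
  | C c => simp [sliceR]
  | add p q hp hq => simp only [map_add, hp, hq]
  | mul_X p i hp => rw [map_mul, map_mul, hp]; rcases i with i | i <;> simp [sliceR]

theorem pderiv_slice {n : ℕ} (x : Fin n → K) (j : Fin n)
    (p : MvPolynomial (Fin n ⊕ Fin n) K) :
    pderiv j (slice x p) = slice x (pderiv (Sum.inr j) p) := by
  induction p using MvPolynomial.induction_on with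
  | C c => simp [slice]
  | add p q hp hq => simp only [map_add, hp, hq]
  | mul_X p i hp =>
    rw [map_mul, pderiv_mul, pderiv_mul, map_add, map_mul, map_mul, hp]
    congr 2
    rcases i with i | i
    · simp [slice, pderiv_X]
    · by_cases h : i = j
      · subst h; simp [slice]
      · rw [pderiv_X_of_ne (fun h' => h (Sum.inr.inj h'))]
        simp [slice, pderiv_X_of_ne h]

theorem isPolyMap_add (c : A.Elt) : A.IsPolyMap (fun a => c + a) := by
  obtain ⟨P, hP⟩ := A.add_poly
  exact ⟨fun i => slice c.1 (P i), fun a i => by rw [eval_slice]; exact hP _ _ _⟩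

theorem isPolyMap_mul (c : A.Elt) : A.IsPolyMap (fun a => c * a) := by
  obtain ⟨P, hP⟩ := A.mul_poly
  exact ⟨fun i => slice c.1 (P i), fun a i => by rw [eval_slice]; exact hP _ _ _⟩

theorem isPolyMap_neg : A.IsPolyMap (fun a => -a) := by
  obtain ⟨P, hP⟩ := A.neg_poly
  exact ⟨P, fun a i => hP _ _⟩

variable (A)

theorem noetherianSpace : TopologicalSpace.NoetherianSpace A.Elt := by
  let i : A.Elt → PrimeSpectrum (MvPolynomial (Fin A.n) K) := fun a => pointToPoint a.1
  have hi : Topology.IsInducing i := by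
    constructor
    show TopologicalSpace.induced _ (TopologicalSpace.generateFrom _) = _
    rw [PrimeSpectrum.isTopologicalBasis_basic_opens.eq_generateFrom,
      induced_generateFrom_eq, induced_generateFrom_eq]
    congr 1
    have key : ∀ p : MvPolynomial (Fin A.n) K,
        (fun x : A.Elt => x.1) ⁻¹' {x | eval x p ≠ 0} =
        i ⁻¹' (PrimeSpectrum.basicOpen p : Set (PrimeSpectrum (MvPolynomial (Fin A.n) K))) := by
      intro p
      ext a
      show eval a.1 p ≠ 0 ↔ ¬ (p ∈ vanishingIdeal K {a.1})
      rw [mem_vanishingIdeal_singleton_iff]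
      rfl
    ext U
    constructor
    · rintro ⟨_, ⟨p, rfl⟩, rfl⟩
      exact ⟨_, ⟨p, rfl⟩, (key p).symm⟩
    · rintro ⟨_, ⟨p, rfl⟩, rfl⟩
      exact ⟨_, ⟨p, rfl⟩, key p⟩
  exact hi.noetherianSpace

theorem isIrreducible_univ [ConnectedSpace A.Elt] : IsPreirreducible (Set.univ : Set A.Elt) := by
  have := A.noetherianSpace
  let Z := irreducibleComponent (0 : A.Elt)
  have hZ : Z ∈ irreducibleComponents A.Elt := irreducibleComponent_mem_irreducibleComponents 0
  have hZmax := hZ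
  obtain ⟨U, hU, ⟨u, hu⟩, hUZ⟩ :=
    TopologicalSpace.NoetherianSpace.exists_isOpen_nonempty_subset_irreducibleComponent Z hZ
  have hZi : IsIrreducible Z := isIrreducible_irreducibleComponent
  have hZc : IsClosed Z := isClosed_irreducibleComponent
  have hopen : IsOpen Z := by
    rw [isOpen_iff_mem_nhds]
    intro p hp
    -- translate `u` to `p`
    let τ : A.Elt → A.Elt := fun a => (p - u) + a
    let σ : A.Elt → A.Elt := fun a => (u - p) + a
    have hτ : Continuous τ := (isPolyMap_add _).continuous
    have hσ : Continuous σ := (isPolyMap_add _).continuous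
    let W := σ ⁻¹' U
    have hW : IsOpen W := hU.preimage hσ
    have hpW : p ∈ W := by
      show u - p + p ∈ U
      simpa using hu
    let Y := τ '' Z
    have hY : IsIrreducible Y := hZi.image τ hτ.continuousOn
    have hWY : W ⊆ Y := fun a ha => ⟨σ a, hUZ ha, by simp only [τ, σ]; abel⟩
    have hZY : Z ⊆ closure Y := by
      have h1 : Z ⊆ closure (Z ∩ W) :=
        subset_closure_inter_of_isPreirreducible_of_isOpen hZi.isPreirreducible hW ⟨p, hp, hpW⟩
      exact h1.trans (closure_mono (Set.inter_subset_right.trans hWY))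
    have hYZ : closure Y ⊆ Z := hZmax.2 hY.closure hZY
    exact Filter.mem_of_superset (hW.mem_nhds hpW) (hWY.trans (subset_closure.trans hYZ))
  have : Z = Set.univ := IsClopen.eq_univ ⟨hZc, hopen⟩ hZi.nonempty
  rw [← this]
  exact hZi.isPreirreducible

theorem inter_nonempty [ConnectedSpace A.Elt] {U V : Set A.Elt} (hU : IsOpen U) (hV : IsOpen V)
    (hU' : U.Nonempty) (hV' : V.Nonempty) : (U ∩ V).Nonempty := by
  have := A.isIrreducible_univ U V hU hV (by simpa using hU') (by simpa using hV')
  simpa using this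

theorem isDomain_coord [ConnectedSpace A.Elt] : IsDomain A.Coord := by
  have : Nontrivial A.Coord := ⟨0, 1, fun h => by
    have := congrArg (fun g : A.Coord => g.1 0) h
    exact zero_ne_one this⟩
  have : NoZeroDivisors A.Coord := ⟨by
    intro f g hfg
    by_contra! hne
    obtain ⟨p, rfl⟩ := A.ev_surj f
    obtain ⟨q, rfl⟩ := A.ev_surj g
    have aux : ∀ p : MvPolynomial (Fin A.n) K, A.ev p ≠ 0 →
        {a : A.Elt | eval a.1 p ≠ 0}.Nonempty := by
      intro p hp
      by_contra hemp
      apply hp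
      apply Subtype.ext
      funext a
      rw [ev_apply]
      by_contra hh
      exact hemp ⟨a, hh⟩
    obtain ⟨a, h1, h2⟩ := A.inter_nonempty (isOpen_ne p) (isOpen_ne q) (aux p hne.1) (aux q hne.2)
    have := congrArg (fun g : A.Coord => g.1 a) hfg
    have h3 : (A.ev p).1 a * (A.ev q).1 a = 0 := this
    rw [ev_apply, ev_apply] at h3
    exact (mul_ne_zero h1 h2) h3⟩
  exact NoZeroDivisors.to_isDomain _

/-- evaluation at a point -/
noncomputable def pt (a : A.Elt) : A.Coord →ₐ[K] K := (Pi.evalAlgHom K (fun _ => K) a).comp A.Coord.val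

theorem pt_apply (a : A.Elt) (g : A.Coord) : A.pt a g = g.1 a := rfl

theorem pt_isMaximal (a : A.Elt) : (RingHom.ker (A.pt a)).IsMaximal :=
  RingHom.ker_isMaximal_of_surjective _ fun c => ⟨algebraMap K _ c, (A.pt a).commutes c⟩

theorem exists_pt [IsAlgClosed K] (M : Ideal A.Coord) (hM : M.IsMaximal) :
    ∃ a : A.Elt, M = RingHom.ker (A.pt a) := by
  have h1 : (M.comap A.ev).IsMaximal := Ideal.comap_isMaximal_of_surjective A.ev A.ev_surj
  obtain ⟨x, hx⟩ := isMaximal_iff_eq_vanishingIdeal_singleton.1 h1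
  have hxA : x ∈ A.carrier := by
    obtain ⟨S, hS⟩ := A.carrier_closed
    rw [hS]
    intro p hp
    have : p ∈ M.comap A.ev := by
      rw [Ideal.mem_comap]
      have : A.ev p = 0 := by
        apply Subtype.ext
        funext a
        rw [ev_apply]
        have h' : ∀ y ∈ A.carrier, eval y p = 0 := fun y hy => by
          rw [hS] at hy
          exact hy p hp
        exact h' _ a.2
      rw [this]; exact M.zero_mem
    rw [hx, mem_vanishingIdeal_singleton_iff] at this
    exact this
  obtain ⟨a, ha⟩ : ∃ a : A.Elt, a.1 = x := ⟨⟨x, hxA⟩, rfl⟩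
  refine ⟨a, ?_⟩
  refine hM.eq_of_le (pt_isMaximal A _).ne_top ?_
  intro g hg
  obtain ⟨p, rfl⟩ := A.ev_surj g
  have : p ∈ M.comap A.ev := hg
  rw [hx, mem_vanishingIdeal_singleton_iff] at this
  rw [RingHom.mem_ker, pt_apply, ev_apply, ha]
  exact this

theorem pt_inj {a b : A.Elt} (h : RingHom.ker (A.pt a) = RingHom.ker (A.pt b)) : a = b := by
  apply Subtype.ext
  funext i
  have h1 : A.ev (X i) - algebraMap K _ (b.1 i) ∈ RingHom.ker (A.pt b) := by
    rw [RingHom.mem_ker, map_sub, AlgHom.commutes, pt_apply, ev_apply]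
    simp
  rw [← h, RingHom.mem_ker, map_sub, AlgHom.commutes, pt_apply, ev_apply] at h1
  simpa [sub_eq_zero] using h1

/-- A dominant polynomial self-map hits a nonempty open set. -/
theorem exists_open_range [IsAlgClosed K] [ConnectedSpace A.Elt] {f : A.Elt → A.Elt}
    (hf : A.IsPolyMap f) (hinj : Function.Injective hf.pull) :
    ∃ V : Set A.Elt, IsOpen V ∧ V.Nonempty ∧ V ⊆ Set.range f := by
  have := A.isDomain_coord
  have hft : hf.pull.toRingHom.FinitePresentation := by
    apply RingHom.FinitePresentation.of_finiteType.1
    have h1 : Algebra.FiniteType K A.Coord := Algebra.FiniteType.of_surjective A.ev A.ev_surj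
    have h2 : (algebraMap K A.Coord).FiniteType := (RingHom.finiteType_algebraMap).2 h1
    refine RingHom.FiniteType.of_comp_finiteType (f := algebraMap K A.Coord) ?_
    convert h2
    exact hf.pull.comp_algebraMap
  obtain ⟨g, hg0, hg⟩ := exists_basicOpen_subset_range hf.pull.toRingHom hft hinj
  obtain ⟨p, rfl⟩ := A.ev_surj g
  refine ⟨{a | eval a.1 p ≠ 0}, isOpen_ne p, ?_, ?_⟩
  · by_contra hemp
    apply hg0
    apply Subtype.ext
    funext a
    rw [ev_apply]
    by_contra hh
    exact hemp ⟨a, hh⟩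
  · intro a ha
    have hmax := A.pt_isMaximal a
    obtain ⟨Q, hQ⟩ := hg ⟨RingHom.ker (A.pt a), hmax.isPrime⟩ (by
      show ¬ (A.ev p ∈ RingHom.ker (A.pt a))
      rw [RingHom.mem_ker, pt_apply, ev_apply]
      exact ha)
    obtain ⟨M, hM, hQM⟩ := Ideal.exists_le_maximal Q.asIdeal Q.2.ne_top
    obtain ⟨b, rfl⟩ := A.exists_pt M hM
    refine ⟨b, ?_⟩
    apply A.pt_inj
    symm
    refine hmax.eq_of_le (pt_isMaximal A _).ne_top ?_
    have hQ' : Ideal.comap hf.pull.toRingHom Q.asIdeal = RingHom.ker (A.pt a) := hQ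
    rw [← hQ']
    intro x hx
    exact hQM hx

theorem exists_nhd_injective [ConnectedSpace A.Elt] :
    ∃ D : MvPolynomial (Fin A.n) K, eval (1 : A.Elt).1 D ≠ 0 ∧
      ∀ x : A.Elt, eval x.1 D ≠ 0 → Function.Injective (isPolyMap_mul x).pull := by
  have := A.isDomain_coord
  obtain ⟨P, hP⟩ := A.mul_poly
  let z : Fin A.n → K := (0 : A.Elt).1
  let o : Fin A.n → K := (1 : A.Elt).1
  let J : Matrix (Fin A.n) (Fin A.n) (MvPolynomial (Fin A.n) K) := fun i j =>
    sliceR z (pderiv (Sum.inr j) (P i))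
  let J' : Matrix (Fin A.n) (Fin A.n) (MvPolynomial (Fin A.n) K) :=
    J - (J.map (eval o)).map C + 1
  have hJ' : ∀ x : Fin A.n → K, J'.map (eval x) = J.map (eval x) - J.map (eval o) + 1 := by
    intro x
    ext i j
    simp [J', Matrix.one_apply, apply_ite (eval x)]
  refine ⟨J'.det, ?_, ?_⟩
  · rw [RingHom.map_det]
    show (J'.map (eval o)).det ≠ 0
    rw [hJ']; simp
  intro x hx
  rw [RingHom.map_det] at hx
  change (J'.map (eval x.1)).det ≠ 0 at hx
  set B : Matrix (Fin A.n) (Fin A.n) K := J'.map (eval x.1) with hB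
  let G : Fin A.n → MvPolynomial (Fin A.n) K := fun i => slice x.1 (P i) - slice o (P i) + X i
  have hG : ∀ a : A.Elt, ∀ i, (x * a).1 i = eval a.1 (G i) := by
    intro a i
    have h1 : (x * a).1 i = eval (Sum.elim x.1 a.1) (P i) := hP _ _ _
    have h2 : ((1 : A.Elt) * a).1 i = eval (Sum.elim o a.1) (P i) := hP _ _ _
    rw [one_mul] at h2
    simp only [G, map_add, map_sub, eval_slice, eval_X]
    rw [h1, ← h2]; ring
  have hGB : ∀ i j, eval z (pderiv j (G i)) = B i j := by
    intro i j
    rw [hB, hJ']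
    simp only [G, map_add, map_sub, pderiv_slice, eval_slice, Matrix.add_apply, Matrix.sub_apply,
      pderiv_X]
    have hJs : ∀ y : Fin A.n → K, (J.map (eval y)) i j =
        eval (Sum.elim y z) (pderiv (Sum.inr j) (P i)) := fun y => eval_sliceR y z _
    rw [hJs, hJs]
    congr 1
    by_cases h : i = j
    · subst h
      rw [Pi.single_eq_same, Matrix.one_apply_eq, map_one]
    · rw [Pi.single_eq_of_ne h, Matrix.one_apply_ne h, map_zero]
  let m : Ideal A.Coord := RingHom.ker (A.pt 0)
  let T : Fin A.n → A.Coord := fun i => A.ev (X i) - algebraMap K _ (z i)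
  have hT : ∀ i, T i ∈ m := by
    intro i
    show _ ∈ RingHom.ker _
    rw [RingHom.mem_ker, map_sub, AlgHom.commutes, pt_apply, ev_apply]
    simp [z]
  have tay := taylor_one A.ev z m hT
  have hfT : ∀ i, (isPolyMap_mul x).pull (T i) - ∑ j, algebraMap K _ (B i j) * T j ∈ m ^ 2 := by
    intro i
    have e1 : (isPolyMap_mul x).pull (T i) = A.ev (G i) - algebraMap K _ (eval z (G i)) := by
      have h0 : eval z (G i) = z i := by
        rw [← hG 0 i, mul_zero]
      rw [h0, map_sub, AlgHom.commutes]
      congr 1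
      apply Subtype.ext
      funext a
      rw [IsPolyMap.pull_apply, ev_apply, ev_apply, eval_X, hG]
    rw [e1]
    have := tay (G i)
    simp only [hGB] at this
    exact this
  refine injective_of_cotangent m (A.pt_isMaximal 0).ne_top (isPolyMap_mul x).pull.toRingHom
    ?_ ?_ ?_
  · intro a ha
    show A.pt 0 ((isPolyMap_mul x).pull a) = 0
    rw [pt_apply, IsPolyMap.pull_apply, mul_zero]
    exact ha
  · intro a
    refine ⟨algebraMap K _ (A.pt 0 a), ?_⟩
    have : (isPolyMap_mul x).pull.toRingHom (algebraMap K _ (A.pt 0 a)) =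
      algebraMap K _ (A.pt 0 a) := (isPolyMap_mul x).pull.commutes _
    rw [this]
    show _ ∈ RingHom.ker _
    rw [RingHom.mem_ker, map_sub, AlgHom.commutes]
    simp
  · intro a ha
    obtain ⟨p, rfl⟩ := A.ev_surj a
    have hp0 : eval z p = 0 := by
      have : A.pt 0 (A.ev p) = 0 := ha
      rwa [pt_apply, ev_apply] at this
    have h1 := tay p
    rw [hp0, map_zero, sub_zero] at h1
    let c : Fin A.n → K := fun j => eval z (pderiv j p)
    let d : Fin A.n → K := Matrix.vecMul c B⁻¹
    have hd : Matrix.vecMul d B = c := by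
      simp only [d]
      rw [Matrix.vecMul_vecMul, Matrix.nonsing_inv_mul _ (isUnit_iff_ne_zero.2 hx),
        Matrix.vecMul_one]
    refine ⟨∑ i, algebraMap K _ (d i) * T i,
      Ideal.sum_mem _ fun i _ => Ideal.mul_mem_left _ _ (hT i), ?_⟩
    have e2 : (isPolyMap_mul x).pull.toRingHom (∑ i, algebraMap K _ (d i) * T i) =
        ∑ i, algebraMap K _ (d i) * (isPolyMap_mul x).pull (T i) := by
      show (isPolyMap_mul x).pull _ = _
      rw [map_sum]
      simp only [map_mul, AlgHom.commutes]
    rw [e2]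
    have e3 : ∑ j, algebraMap K A.Coord (c j) * T j =
        ∑ i, algebraMap K A.Coord (d i) * ∑ j, algebraMap K _ (B i j) * T j := by
      rw [← hd]
      simp only [Matrix.vecMul, dotProduct, map_sum, map_mul, Finset.mul_sum, Finset.sum_mul]
      rw [Finset.sum_comm]
      exact Finset.sum_congr rfl fun _ _ => Finset.sum_congr rfl fun _ _ => by ring
    have h2 : ∑ i, algebraMap K A.Coord (d i) * ((isPolyMap_mul x).pull (T i) -
        ∑ j, algebraMap K _ (B i j) * T j) ∈ m ^ 2 :=
      Ideal.sum_mem _ fun i _ => Ideal.mul_mem_left _ _ (hfT i)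
    simp only [mul_sub, Finset.sum_sub_distrib] at h2
    rw [← e3] at h2
    convert sub_mem h1 h2 using 1
    show _ = A.ev p - (∑ j, algebraMap K A.Coord (c j) * T j) - _
    ring

theorem isUnit_of_injective [IsAlgClosed K] [ConnectedSpace A.Elt] (x : A.Elt)
    (hx : Function.Injective (isPolyMap_mul x).pull) : IsUnit x := by
  obtain ⟨V, hV, ⟨v, hv⟩, hVr⟩ := A.exists_open_range (isPolyMap_mul x) hx
  have hc : Continuous (fun a : A.Elt => 1 + -a) :=
    (isPolyMap_add 1).continuous.comp isPolyMap_neg.continuous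
  obtain ⟨w, hw1, hw2⟩ := A.inter_nonempty hV (hV.preimage hc) ⟨v, hv⟩
    ⟨1 + -v, by simpa using hv⟩
  obtain ⟨y1, h1⟩ := hVr hw1
  obtain ⟨y2, h2⟩ := hVr hw2
  have hxy : x * (y1 + y2) = 1 := by
    rw [mul_add]
    change x * y1 = w at h1
    change x * y2 = 1 + -w at h2
    rw [h1, h2]; abel
  generalize y1 + y2 = y at hxy
  have hs : Function.Surjective (isPolyMap_mul y).pull.toRingHom := by
    intro g
    refine ⟨(isPolyMap_mul x).pull g, ?_⟩
    apply Subtype.ext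
    funext a
    show g.1 (x * (y * a)) = g.1 a
    rw [← mul_assoc, hxy, one_mul]
  have hi := ringEndo_injective_of_surjective _ hs
  have hyx : y * x = 1 := by
    apply A.pt_inj
    ext g
    rw [RingHom.mem_ker, RingHom.mem_ker, pt_apply, pt_apply]
    have : (isPolyMap_mul x).pull ((isPolyMap_mul y).pull g) = g := by
      apply hi
      apply Subtype.ext
      funext a
      show g.1 (y * (x * (y * a))) = g.1 (y * a)
      rw [← mul_assoc x, hxy, one_mul]
    have := congrArg (fun g : A.Coord => g.1 1) this
    change g.1 (y * (x * 1)) = g.1 1 at this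
    rw [mul_one] at this
    rw [this]
  exact ⟨⟨x, y, hxy, hyx⟩, rfl⟩

end AlgebraicRing

/-- A connected algebraic ring over an algebraically closed field satisfies
`A = Aˣ - Aˣ`: every element is a difference of two units. -/
theorem stmt_2 (K : Type) [Field K] [IsAlgClosed K] (A : AlgebraicRing K)
    [ConnectedSpace A.Elt] :
    ∀ a : A.Elt, ∃ u v : A.Elt, IsUnit u ∧ IsUnit v ∧ a = u - v := by
  intro a
  obtain ⟨D, hD1, hD⟩ := A.exists_nhd_injective
  have hU : IsOpen {x : A.Elt | eval x.1 D ≠ 0} := AlgebraicRing.isOpen_ne D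
  have hc : Continuous (fun x : A.Elt => -a + x) := (AlgebraicRing.isPolyMap_add (-a)).continuous
  obtain ⟨u, hu1, hu2⟩ := A.inter_nonempty hU (hU.preimage hc) ⟨1, hD1⟩
    ⟨a + 1, by simpa using hD1⟩
  refine ⟨u, -a + u, A.isUnit_of_injective _ (hD _ hu1), A.isUnit_of_injective _ (hD _ hu2), ?_⟩
  abel
end

section
/- Let $A$ be a commutative algebraic ring over an algebraically closed field $K$ whose connected component $A^{\circ}$ of $0$ is finitely generated as an ideal of $A$. Then $A^{\circ}$ possesses an identity element for multiplication, i.e., there exists an idempotent $e \in A^{\circ}$ with $ex = x$ for all $x \in A^{\circ}$. -/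
namespace Stmt7Aux

open MvPolynomial PrimeSpectrum Topology

/-- a finite union of locally closed sets contains a nonempty relatively open part of its closure -/
lemma exists_open_of_biUnion {X ι : Type*} [TopologicalSpace X] (U Z : ι → Set X)
    (hU : ∀ i, IsOpen (U i)) (hZ : ∀ i, IsClosed (Z i)) (s : Finset ι)
    (hne : (⋃ i ∈ s, U i ∩ Z i).Nonempty) :
    ∃ V : Set X, IsOpen V ∧ (V ∩ ⋃ i ∈ s, U i ∩ Z i).Nonempty ∧
      V ∩ closure (⋃ i ∈ s, U i ∩ Z i) ⊆ ⋃ i ∈ s, U i ∩ Z i := by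
  classical
  induction s using Finset.induction_on with
  | empty => simp at hne
  | insert a s ha ih =>
    rw [Finset.set_biUnion_insert] at hne ⊢
    set H := ⋃ i ∈ s, U i ∩ Z i with hH
    by_cases h : U a ∩ Z a ⊆ closure H
    · have hHne : H.Nonempty := by
        obtain ⟨x, hx | hx⟩ := hne
        · exact closure_nonempty_iff.1 ⟨x, h hx⟩
        · exact ⟨x, hx⟩
      obtain ⟨V, hV, ⟨y, hy, hy'⟩, hVH⟩ := ih hHne
      refine ⟨V, hV, ⟨y, hy, Or.inr hy'⟩, ?_⟩
      rintro x ⟨hx, hx'⟩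
      right
      refine hVH ⟨hx, ?_⟩
      have : closure (U a ∩ Z a ∪ H) ⊆ closure H :=
        closure_minimal (Set.union_subset h subset_closure) isClosed_closure
      exact this hx'
    · obtain ⟨y, hy, hy'⟩ := Set.not_subset.1 h
      refine ⟨U a ∩ (closure H)ᶜ, (hU a).inter isClosed_closure.isOpen_compl,
        ⟨y, ⟨hy.1, hy'⟩, Or.inl hy⟩, ?_⟩
      rintro x ⟨⟨hx, hx'⟩, hx2⟩
      rw [closure_union] at hx2
      rcases hx2 with hx2 | hx2
      · left
        exact ⟨hx, closure_minimal Set.inter_subset_right (hZ a) hx2⟩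
      · exact absurd hx2 hx'

/-- subgroup containing a relatively open part of its closure is closed -/
lemma isClosed_of_locallyClosed {G : Type*} [AddCommGroup G] [TopologicalSpace G]
    (hadd : ∀ a : G, Continuous fun x : G => a + x) (hneg : Continuous fun x : G => -x)
    (H : AddSubgroup G) (V : Set G) (hV : IsOpen V) (hne : (V ∩ H).Nonempty)
    (hVH : V ∩ closure (H : Set G) ⊆ H) : IsClosed (H : Set G) := by
  have htr : ∀ h ∈ H, ∀ y ∈ closure (H : Set G), h + y ∈ closure (H : Set G) := fun h hh y hy =>
    map_mem_closure (hadd h) hy (fun z hz => H.add_mem hh hz)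
  have hng : ∀ y ∈ closure (H : Set G), -y ∈ closure (H : Set G) := fun y hy =>
    map_mem_closure hneg hy (fun z hz => H.neg_mem hz)
  obtain ⟨u, huV, huH⟩ := hne
  refine isClosed_of_closure_subset fun y hy => ?_
  have h1 : u + -y ∈ closure (H : Set G) := htr u huH _ (hng y hy)
  obtain ⟨h, hhV, hhH⟩ := mem_closure_iff.1 h1 ((fun x => y + x) ⁻¹' V) (hV.preimage (hadd y))
    (by simpa using huV)
  have h2 : y + h ∈ H := hVH ⟨hhV, by rw [add_comm]; exact htr h hhH y hy⟩
  simpa using H.sub_mem h2 hhH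

section pt
variable {K : Type} [Field K] {σ : Type}

noncomputable def pt (x : σ → K) : PrimeSpectrum (MvPolynomial σ K) :=
  ⟨RingHom.ker (MvPolynomial.eval x), RingHom.ker_isPrime _⟩

lemma mem_pt (x : σ → K) (p : MvPolynomial σ K) :
    p ∈ (pt x).asIdeal ↔ MvPolynomial.eval x p = 0 := RingHom.mem_ker

lemma affineZariski_eq (n : ℕ) : affineZariski K n =
    TopologicalSpace.induced (pt : (Fin n → K) → _) inferInstance := by
  rw [affineZariski, (isTopologicalBasis_basic_opens
    (R := MvPolynomial (Fin n) K)).eq_generateFrom, induced_generateFrom_eq]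
  congr 1
  ext U
  constructor
  · rintro ⟨p, rfl⟩
    refine ⟨_, ⟨p, rfl⟩, ?_⟩
    ext x
    simp [mem_pt]
  · rintro ⟨_, ⟨p, rfl⟩, rfl⟩
    refine ⟨p, ?_⟩
    ext x
    simp [mem_pt]

lemma image_iff [IsAlgClosed K] [Finite σ] {n : ℕ} (P : Fin n → MvPolynomial σ K)
    (S : Set (MvPolynomial σ K)) (y : Fin n → K) :
    pt y ∈ comap (bind₁ P : MvPolynomial (Fin n) K →ₐ[K] MvPolynomial σ K).toRingHom ''
      zeroLocus S ↔
    ∃ x : σ → K, (∀ p ∈ S, MvPolynomial.eval x p = 0) ∧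
      ∀ i, y i = MvPolynomial.eval x (P i) := by
  constructor
  · rintro ⟨Q, hQ, hQy⟩
    obtain ⟨M, hM, hQM⟩ := Q.asIdeal.exists_le_maximal Q.isPrime.ne_top
    obtain ⟨x, hx⟩ := isMaximal_iff_eq_vanishingIdeal_singleton.1 hM
    have hmem : ∀ p, p ∈ M → MvPolynomial.eval x p = 0 := by
      intro p hp
      rw [hx, mem_vanishingIdeal_singleton_iff] at hp
      simpa [aeval_eq_eval] using hp
    refine ⟨x, fun p hp => hmem p (hQM (hQ hp)), fun i => ?_⟩
    have h1 : (X i - C (y i) : MvPolynomial (Fin n) K) ∈ (pt y).asIdeal := by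
      rw [mem_pt]; simp
    rw [← hQy] at h1
    have h2 := hmem _ (hQM h1)
    simp [sub_eq_zero] at h2
    exact h2.symm
  · rintro ⟨x, hx, hxy⟩
    refine ⟨pt x, fun p hp => (mem_pt x p).2 (hx p hp), ?_⟩
    ext p
    have : y = fun i => MvPolynomial.eval x (P i) := funext hxy
    rw [mem_pt]
    change (bind₁ P p) ∈ (pt x).asIdeal ↔ _
    rw [mem_pt, this]
    have h3 : MvPolynomial.eval x (bind₁ P p) =
        MvPolynomial.eval (fun i => MvPolynomial.eval x (P i)) p := by
      exact eval₂Hom_bind₁ (RingHom.id K) x P p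
    rw [h3]

lemma finitePres {n : ℕ} [Finite σ] (P : Fin n → MvPolynomial σ K) :
    (bind₁ P : MvPolynomial (Fin n) K →ₐ[K] MvPolynomial σ K).toRingHom.FinitePresentation := by
  rw [← RingHom.FinitePresentation.of_finiteType]
  have h : (C : K →+* MvPolynomial σ K).FiniteType := by
    have : Algebra.FiniteType K (MvPolynomial σ K) := inferInstance
    rw [← MvPolynomial.algebraMap_eq]
    exact (RingHom.finiteType_algebraMap).2 this
  refine RingHom.FiniteType.of_comp_finiteType (f := (C : K →+* MvPolynomial (Fin n) K)) ?_
  convert h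
  ext a
  simp

lemma isConstr [IsAlgClosed K] {n : ℕ} [Finite σ] (P : Fin n → MvPolynomial σ K)
    (S : Set (MvPolynomial σ K)) :
    IsConstructible (comap (bind₁ P : MvPolynomial (Fin n) K →ₐ[K] MvPolynomial σ K).toRingHom ''
      zeroLocus S) := by
  refine isConstructible_comap_image (finitePres P) ?_
  rw [← isConstructible_compl]
  exact (TopologicalSpace.NoetherianSpace.isCompact _).isConstructible
    (isClosed_zeroLocus S).isOpen_compl
end pt

section ring
variable {K : Type} [Field K] (A : CommAlgebraicRing K)

lemma inducing : Topology.IsInducing (fun x : A.Elt => pt x.1) := by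
  constructor
  change TopologicalSpace.induced _ (affineZariski K _) = _
  rw [affineZariski_eq, induced_compose]
  rfl

lemma noeth : TopologicalSpace.NoetherianSpace A.Elt := (inducing A).noetherianSpace

lemma continuous_poly (f : A.Elt → A.Elt) (P : Fin A.n → MvPolynomial (Fin A.n) K)
    (h : ∀ x i, (f x).1 i = MvPolynomial.eval x.1 (P i)) : Continuous f := by
  rw [(inducing A).continuous_iff]
  have : (fun x : A.Elt => pt x.1) ∘ f = 
      comap (bind₁ P : MvPolynomial (Fin A.n) K →ₐ[K] MvPolynomial (Fin A.n) K).toRingHom ∘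
        (fun x : A.Elt => pt x.1) := by
    funext x
    ext p
    have : (f x).1 = fun i => MvPolynomial.eval x.1 (P i) := funext (h x)
    simp only [Function.comp]
    rw [mem_pt]
    change _ ↔ (bind₁ P p) ∈ (pt x.1).asIdeal
    rw [mem_pt, this]
    have h3 : MvPolynomial.eval x.1 (bind₁ P p) =
        MvPolynomial.eval (fun i => MvPolynomial.eval x.1 (P i)) p := by
      exact eval₂Hom_bind₁ (RingHom.id K) x.1 P p
    rw [h3]
  rw [this]
  exact (PrimeSpectrum.continuous_comap _).comp (inducing A).continuous

lemma eval_left (n : ℕ) (a x : Fin n → K) (p : MvPolynomial (Fin n ⊕ Fin n) K) :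
    MvPolynomial.eval x (bind₁ (Sum.elim (fun i => C (a i)) X) p) =
      MvPolynomial.eval (Sum.elim a x) p := by
  have := eval₂Hom_bind₁ (RingHom.id K) x
    (Sum.elim (fun i => C (a i)) X : Fin n ⊕ Fin n → MvPolynomial (Fin n) K) p
  have h2 : (fun i => (eval₂Hom (RingHom.id K) x)
      ((Sum.elim (fun i => C (a i)) X : Fin n ⊕ Fin n → MvPolynomial (Fin n) K) i)) =
      Sum.elim a x := by
    funext i; cases i <;> simp
  rw [h2] at this
  exact this

lemma cont_add (a : A.Elt) : Continuous (fun x : A.Elt => a + x) := by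
  obtain ⟨P, hP⟩ := A.add_poly
  refine continuous_poly A _ (fun i => bind₁ (Sum.elim (fun i => C (a.1 i)) X) (P i)) ?_
  intro x i
  rw [eval_left]
  exact hP a.1 x.1 i

lemma cont_neg : Continuous (fun x : A.Elt => -x) := by
  obtain ⟨P, hP⟩ := A.neg_poly
  exact continuous_poly A _ P (fun x i => hP x.1 i)

/-- closed subsets of `A` are zero loci -/
lemma closed_eq (F : Set A.Elt) (hF : IsClosed F) :
    ∃ S : Set (MvPolynomial (Fin A.n) K), ∀ x : Fin A.n → K,
      (∀ p ∈ S, MvPolynomial.eval x p = 0) ↔ ∃ h : x ∈ A.carrier, (⟨x, h⟩ : A.Elt) ∈ F := by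
  obtain ⟨S₀, hS₀⟩ := A.carrier_closed
  obtain ⟨Z, hZ, rfl⟩ := (inducing A).isClosed_iff.1 hF
  obtain ⟨T, rfl⟩ := (isClosed_iff_zeroLocus Z).1 hZ
  refine ⟨S₀ ∪ T, fun x => ?_⟩
  have h0 : x ∈ A.carrier ↔ ∀ p ∈ S₀, MvPolynomial.eval x p = 0 := by rw [hS₀]; rfl
  constructor
  · intro h
    exact ⟨h0.2 fun p hp => h p (Or.inl hp), fun p hp => (mem_pt _ _).2 (h p (Or.inr hp))⟩
  · rintro ⟨h, h'⟩ p (hp | hp)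
    · exact h0.1 h p hp
    · exact (mem_pt _ _).1 (h' hp)

lemma closed_sup [IsAlgClosed K] (J : Ideal A.Elt) (hJ : IsClosed (J : Set A.Elt)) (t : A.Elt) :
    IsClosed ((Ideal.span {t} ⊔ J : Ideal A.Elt) : Set A.Elt) := by
  obtain ⟨Pa, hPa⟩ := A.add_poly
  obtain ⟨Pm, hPm⟩ := A.mul_poly
  obtain ⟨S, hS⟩ := closed_eq A _ hJ
  obtain ⟨S', hS'⟩ := closed_eq A Set.univ isClosed_univ
  -- polynomial map (u, x) ↦ t * u + x
  let Q : Fin A.n → MvPolynomial (Fin A.n ⊕ Fin A.n) K := fun i =>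
    bind₁ (Sum.elim
      (fun j => rename Sum.inl (bind₁ (Sum.elim (fun i => C (t.1 i)) X) (Pm j)))
      (fun j => X (Sum.inr j))) (Pa i)
  have hQ : ∀ (z : Fin A.n ⊕ Fin A.n → K) i, MvPolynomial.eval z (Q i) =
      A.add (A.mul t.1 (z ∘ Sum.inl)) (z ∘ Sum.inr) i := by
    intro z i
    rw [hPa]
    have := eval₂Hom_bind₁ (RingHom.id K) z (Sum.elim
      (fun j => rename Sum.inl (bind₁ (Sum.elim (fun i => C (t.1 i)) X) (Pm j)))
      (fun j => X (Sum.inr j)) : Fin A.n ⊕ Fin A.n → MvPolynomial (Fin A.n ⊕ Fin A.n) K) (Pa i)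
    refine this.trans ?_
    have h2 : (fun i => (eval₂Hom (RingHom.id K) z) ((Sum.elim
      (fun j => rename Sum.inl (bind₁ (Sum.elim (fun i => C (t.1 i)) X) (Pm j)))
      (fun j => X (Sum.inr j)) : Fin A.n ⊕ Fin A.n → MvPolynomial (Fin A.n ⊕ Fin A.n) K) i)) =
      Sum.elim (A.mul t.1 (z ∘ Sum.inl)) (z ∘ Sum.inr) := by
      funext i
      rcases i with i | i
      · simp only [Sum.elim_inl]
        change MvPolynomial.eval z _ = _
        rw [eval_rename, eval_left, hPm]
      · simp
    rw [h2]
    rfl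
  let SS : Set (MvPolynomial (Fin A.n ⊕ Fin A.n) K) :=
    (rename Sum.inl '' S') ∪ (rename Sum.inr '' S)
  have key : ∀ y : A.Elt, y ∈ (Ideal.span {t} ⊔ J : Ideal A.Elt) ↔
      pt y.1 ∈ comap (bind₁ Q :
        MvPolynomial (Fin A.n) K →ₐ[K] MvPolynomial (Fin A.n ⊕ Fin A.n) K).toRingHom ''
      zeroLocus SS := by
    intro y
    rw [image_iff]
    constructor
    · intro hy
      obtain ⟨a, ha, b, hb, hab⟩ := Submodule.mem_sup.1 hy
      obtain ⟨u, rfl⟩ := Ideal.mem_span_singleton'.1 ha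
      refine ⟨Sum.elim u.1 b.1, ?_, fun i => ?_⟩
      · rintro _ (⟨p, hp, rfl⟩ | ⟨p, hp, rfl⟩)
        · rw [eval_rename]
          exact (hS' u.1).2 ⟨u.2, trivial⟩ p hp
        · rw [eval_rename]
          exact (hS b.1).2 ⟨b.2, hb⟩ p hp
      · rw [hQ, ← hab, mul_comm]
        rfl
    · rintro ⟨z, hz, hzy⟩
      obtain ⟨hu, -⟩ := (hS' (z ∘ Sum.inl)).1 (fun p hp => by
        rw [← eval_rename]; exact hz _ (Or.inl ⟨p, hp, rfl⟩))
      obtain ⟨hb, hbJ⟩ := (hS (z ∘ Sum.inr)).1 (fun p hp => by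
        rw [← eval_rename]; exact hz _ (Or.inr ⟨p, hp, rfl⟩))
      let u : A.Elt := ⟨_, hu⟩
      let b : A.Elt := ⟨_, hb⟩
      have : y = t * u + b := by
        apply Subtype.ext
        funext i
        rw [hzy i, hQ]
        rfl
      rw [this]
      exact Submodule.add_mem_sup
        (Ideal.mul_mem_right _ _ (Ideal.subset_span rfl)) hbJ
  obtain ⟨D, hD⟩ := exists_constructibleSetData_iff.2 (isConstr Q SS)
  have hset : ((Ideal.span {t} ⊔ J : Ideal A.Elt) : Set A.Elt) =
      ⋃ c ∈ D, ((fun x : A.Elt => pt x.1) ⁻¹' (zeroLocus {c.f})ᶜ) ∩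
        ((fun x : A.Elt => pt x.1) ⁻¹' (zeroLocus (Set.range c.g))) := by
    ext y
    rw [SetLike.mem_coe, key, ← hD]
    simp only [ConstructibleSetData.toSet, BasicConstructibleSetData.toSet, Set.mem_iUnion,
      Set.mem_inter_iff, Set.mem_preimage, Set.mem_compl_iff, Set.mem_sdiff]
    tauto
  obtain ⟨V, hV, hne, hVH⟩ := exists_open_of_biUnion
    (fun c : BasicConstructibleSetData (MvPolynomial (Fin A.n) K) =>
      ((fun x : A.Elt => pt x.1) ⁻¹' (zeroLocus {c.f})ᶜ))
    (fun c => ((fun x : A.Elt => pt x.1) ⁻¹' (zeroLocus (Set.range c.g))))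
    (fun c => (isClosed_zeroLocus _).isOpen_compl.preimage (inducing A).continuous)
    (fun c => (isClosed_zeroLocus _).preimage (inducing A).continuous) D
    (by rw [← hset]; exact ⟨0, Submodule.zero_mem _⟩)
  rw [← hset] at hne hVH
  exact isClosed_of_locallyClosed (cont_add A) (cont_neg A)
    (Ideal.span {t} ⊔ J : Ideal A.Elt).toAddSubgroup V hV hne hVH

lemma closed_bot : IsClosed ((⊥ : Ideal A.Elt) : Set A.Elt) := by
  rw [(inducing A).isClosed_iff]
  refine ⟨zeroLocus (Set.range fun i => (X i - C ((0 : A.Elt).1 i) : MvPolynomial (Fin A.n) K)),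
    isClosed_zeroLocus _, ?_⟩
  ext y
  simp only [Set.mem_preimage, mem_zeroLocus, SetLike.mem_coe, Submodule.mem_bot]
  constructor
  · intro h
    apply Subtype.ext
    funext i
    have := (mem_pt _ _).1 (h ⟨i, rfl⟩)
    simpa [sub_eq_zero] using this
  · rintro rfl _ ⟨i, rfl⟩
    rw [SetLike.mem_coe, mem_pt]
    simp

lemma closed_fg [IsAlgClosed K] (J : Ideal A.Elt) (hJ : J.FG) : IsClosed (J : Set A.Elt) := by
  classical
  obtain ⟨s, rfl⟩ := hJ
  induction s using Finset.induction_on with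
  | empty => simpa using closed_bot A
  | insert a s _ ih =>
    rw [Finset.coe_insert, Ideal.span_insert]
    exact closed_sup A _ ih a

lemma finite_quot (J : Ideal A.Elt) (hJ : (J : Set A.Elt) = connectedComponent 0) :
    Finite (A.Elt ⧸ J) := by
  have := noeth A
  have hf := TopologicalSpace.NoetherianSpace.finite_irreducibleComponents (α := A.Elt)
  have := hf.to_subtype
  refine Finite.of_injective (fun q : A.Elt ⧸ J =>
    (⟨irreducibleComponent (Quotient.out q), irreducibleComponent_mem_irreducibleComponents _⟩ :
      irreducibleComponents A.Elt)) ?_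
  intro q q' h
  have h' : irreducibleComponent (Quotient.out q) = irreducibleComponent (Quotient.out q') :=
    congrArg Subtype.val h
  rw [← Ideal.Quotient.mk_out q, ← Ideal.Quotient.mk_out q']
  symm
  rw [Ideal.Quotient.eq]
  rw [← SetLike.mem_coe, hJ]
  set a := Quotient.out q
  set b := Quotient.out q'
  have hpre : IsPreconnected ((fun x : A.Elt => -a + x) '' irreducibleComponent a) :=
    (isIrreducible_irreducibleComponent.isPreirreducible.isPreconnected).image _
      (cont_add A (-a)).continuousOn
  refine hpre.subset_connectedComponent ⟨a, mem_irreducibleComponent, by simp⟩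
    ⟨b, by rw [h']; exact mem_irreducibleComponent, ?_⟩
  exact neg_add_eq_sub a b

end ring

lemma isOpen_of_finite {G : Type*} [CommRing G] [TopologicalSpace G]
    (hadd : ∀ a : G, Continuous fun x : G => a + x) (J : Ideal G) [Finite (G ⧸ J)]
    (hJ : IsClosed (J : Set G)) : IsOpen (J : Set G) := by
  have : (J : Set G)ᶜ = ⋃ q ∈ {q : G ⧸ J | q ≠ 0},
      (fun x => -(Quotient.out q) + x) ⁻¹' (J : Set G) := by
    ext x
    simp only [Set.mem_compl_iff, SetLike.mem_coe, Set.mem_iUnion, Set.mem_preimage,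
      Set.mem_ofPred_eq, exists_prop]
    have h : ∀ q : G ⧸ J, -(Quotient.out q) + x ∈ J ↔ Ideal.Quotient.mk J x = q := by
      intro q
      rw [neg_add_eq_sub, ← Ideal.Quotient.eq, Ideal.Quotient.mk_out]
    simp only [h]
    rw [← Ideal.Quotient.eq_zero_iff_mem]
    simp
  rw [← isClosed_compl_iff, this]
  exact (Set.toFinite _).isClosed_biUnion fun q _ => hJ.preimage (hadd _)

end Stmt7Aux

/-- If the connected component `A°` of `0` in a commutative algebraic ring `A`
over an algebraically closed field is finitely generated as an ideal of `A`, then `A°` has a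
multiplicative identity: an idempotent `e ∈ A°` with `e * x = x` for all `x ∈ A°`. -/
theorem stmt_7 (K : Type) [Field K] [IsAlgClosed K] (A : CommAlgebraicRing K)
    (hfg : ∃ s : Finset A.Elt,
      ((Ideal.span (s : Set A.Elt) : Ideal A.Elt) : Set A.Elt) =
        connectedComponent (0 : A.Elt)) :
    ∃ e : A.Elt, e ∈ connectedComponent (0 : A.Elt) ∧ e * e = e ∧
      ∀ x ∈ connectedComponent (0 : A.Elt), e * x = x := by
  obtain ⟨s, hs⟩ := hfg
  set J : Ideal A.Elt := Ideal.span (s : Set A.Elt) with hJdef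
  have hJfg : J.FG := ⟨s, rfl⟩
  have hfin := Stmt7Aux.finite_quot A J hs
  have hfin2 : Finite (A.Elt ⧸ J ^ 2) := Ideal.finite_quotient_pow hJfg 2
  have hcl := Stmt7Aux.closed_fg A (J ^ 2) (hJfg.pow)
  have hop := Stmt7Aux.isOpen_of_finite (Stmt7Aux.cont_add A) (J ^ 2) hcl
  have hsub : connectedComponent (0 : A.Elt) ⊆ ((J ^ 2 : Ideal A.Elt) : Set A.Elt) :=
    IsClopen.connectedComponent_subset ⟨hcl, hop⟩ (Submodule.zero_mem _)
  have hid : IsIdempotentElem J := by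
    change J * J = J
    rw [← pow_two]
    refine le_antisymm (Ideal.pow_le_self two_ne_zero) ?_
    intro x hx
    exact hsub (hs ▸ hx)
  obtain ⟨e, he, hJe⟩ := (Ideal.isIdempotentElem_iff_of_fg J hJfg).1 hid
  refine ⟨e, ?_, he, fun x hx => ?_⟩
  · rw [← hs, hJe]
    exact Submodule.mem_span_singleton_self e
  · rw [← hs, hJe] at hx
    obtain ⟨r, rfl⟩ := Submodule.mem_span_singleton.1 hx
    rw [smul_eq_mul, mul_left_comm, he.eq]
end

section
/- Let $f : R \to A$ be an abstract ring homomorphism from a commutative noetherian ring $R$ into a commutative algebraic ring $A$ over an algebraically closed field $K$, such that $f(R)$ is Zariski-dense in $A$. Then the connected component $A^{\circ}$ of $0$ is finitely generated as an ideal of $A$. -/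
open MvPolynomial

namespace S9

theorem good {X ι : Type*} [TopologicalSpace X] (t : Finset ι) (F G : ι → Set X)
    (hF : ∀ i, IsClosed (F i)) (hG : ∀ i, IsClosed (G i)) :
    (⋃ i ∈ t, F i \ G i).Nonempty →
    ∃ U : Set X, IsOpen U ∧ (U ∩ ⋃ i ∈ t, F i \ G i).Nonempty ∧
      U ∩ closure (⋃ i ∈ t, F i \ G i) ⊆ ⋃ i ∈ t, F i \ G i := by
  classical
  induction t using Finset.induction_on with
  | empty => simp
  | insert a t ha ih =>
    rw [Finset.set_biUnion_insert]
    set S := ⋃ i ∈ t, F i \ G i with hS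
    intro hne
    by_cases h : F a \ G a ⊆ closure S
    · have hcl : closure (F a \ G a ∪ S) = closure S := by
        apply subset_antisymm
        · exact closure_minimal (Set.union_subset h subset_closure) isClosed_closure
        · exact closure_mono Set.subset_union_right
      have hSne : S.Nonempty := by
        rw [← closure_nonempty_iff, ← hcl, closure_nonempty_iff]; exact hne
      obtain ⟨U, hU, hUne, hsub⟩ := ih hSne
      refine ⟨U, hU, hUne.mono (by gcongr; exact Set.subset_union_right), ?_⟩
      rw [hcl]
      exact hsub.trans Set.subset_union_right
    · obtain ⟨x, hx, hxS⟩ := Set.not_subset.1 h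
      refine ⟨(closure S)ᶜ ∩ (G a)ᶜ, isClosed_closure.isOpen_compl.inter (hG a).isOpen_compl,
        ⟨x, ⟨hxS, hx.2⟩, Or.inl hx⟩, ?_⟩
      rw [closure_union]
      rintro y ⟨⟨h1, h2⟩, h3 | h3⟩
      · exact Or.inl ⟨closure_minimal Set.sdiff_subset (hF a) h3, h2⟩
      · exact absurd h3 h1

theorem closed_subgroup {X ι : Type*} [TopologicalSpace X] [AddCommGroup X]
    (hadd : ∀ c : X, Continuous (fun x => x + c)) (hneg : Continuous (fun x : X => -x))
    (J : AddSubgroup X) (t : Finset ι) (F G : ι → Set X)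
    (hF : ∀ i, IsClosed (F i)) (hG : ∀ i, IsClosed (G i))
    (hJ : (J : Set X) = ⋃ i ∈ t, F i \ G i) : IsClosed (J : Set X) := by
  obtain ⟨U, hU, ⟨g, hgU, hgJ⟩, hsub⟩ := good t F G hF hG (hJ ▸ ⟨0, J.zero_mem⟩)
  rw [← hJ] at hgJ hsub
  have htr : ∀ c ∈ J, ∀ x ∈ closure (J : Set X), x + c ∈ closure (J : Set X) := by
    intro c hc x hx
    exact map_mem_closure (f := fun x => x + c) (hadd c) hx (fun y hy => J.add_mem hy hc)
  refine isClosed_of_closure_subset fun x hx => ?_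
  have hV : IsOpen {y : X | -y + (x + g) ∈ U} :=
    hU.preimage ((hadd (x + g)).comp hneg)
  obtain ⟨y, hyV, hyJ⟩ := mem_closure_iff.1 hx _ hV (by simpa using hgU)
  have h1 : -y + (x + g) ∈ J := by
    apply hsub
    refine ⟨hyV, ?_⟩
    have := htr (-y + g) (J.add_mem (J.neg_mem hyJ) hgJ) x hx
    convert this using 1
    abel
  have h2 : x = (-y + (x + g)) + (y - g) := by abel
  rw [h2]
  exact J.add_mem h1 (J.sub_mem hyJ hgJ)

theorem isOpen_component {X : Type*} [TopologicalSpace X] [TopologicalSpace.NoetherianSpace X]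
    (x : X) : IsOpen (connectedComponent x) := by
  rw [← isClosed_compl_iff]
  have : (connectedComponent x)ᶜ =
      ⋃ Z ∈ {Z ∈ irreducibleComponents X | Disjoint Z (connectedComponent x)}, Z := by
    ext y
    simp only [Set.mem_iUnion, Set.mem_compl_iff, exists_prop]
    constructor
    · intro hy
      refine ⟨irreducibleComponent y, ⟨irreducibleComponent_mem_irreducibleComponents y, ?_⟩,
        mem_irreducibleComponent⟩
      rw [Set.disjoint_left]
      intro z hz hzx
      apply hy
      have h1 : irreducibleComponent y ⊆ connectedComponent z :=
        isIrreducible_irreducibleComponent.isConnected.isPreconnected.subset_connectedComponent hz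
      rw [connectedComponent_eq hzx]
      exact h1 mem_irreducibleComponent
    · rintro ⟨Z, ⟨-, hd⟩, hyZ⟩ hy
      exact Set.disjoint_left.1 hd hyZ hy
  rw [this]
  refine Set.Finite.isClosed_biUnion
    (TopologicalSpace.NoetherianSpace.finite_irreducibleComponents.subset (fun Z h => h.1)) ?_
  intro Z hZ
  exact isClosed_of_mem_irreducibleComponents Z hZ.1

variable {K : Type} [Field K]

theorem eval_aeval' {σ τ : Type} (Q : τ → MvPolynomial σ K) (y : σ → K)
    (p : MvPolynomial τ K) : MvPolynomial.eval y (aeval Q p) =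
      MvPolynomial.eval (fun i => MvPolynomial.eval y (Q i)) p := by
  induction p using MvPolynomial.induction_on with
  | C a => simp
  | add p q hp hq => simp only [map_add, hp, hq]
  | mul_X p i hp => simp only [map_mul, hp, aeval_X, eval_X]

/-- point of the spectrum -/
noncomputable def pt {σ : Type} (x : σ → K) : PrimeSpectrum (MvPolynomial σ K) :=
  ⟨RingHom.ker (MvPolynomial.eval x), RingHom.ker_isPrime _⟩

theorem mem_pt {σ : Type} (x : σ → K) (p : MvPolynomial σ K) :
    p ∈ (pt x).asIdeal ↔ MvPolynomial.eval x p = 0 := Iff.rfl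

theorem affine_eq (n : ℕ) : affineZariski K n =
    TopologicalSpace.induced pt PrimeSpectrum.zariskiTopology := by
  rw [PrimeSpectrum.isTopologicalBasis_basic_opens.eq_generateFrom, induced_generateFrom_eq]
  unfold affineZariski
  congr 1
  ext U
  simp only [Set.mem_setOf_eq, Set.mem_image, Set.mem_range, exists_exists_eq_and]
  constructor
  · rintro ⟨p, rfl⟩; exact ⟨p, rfl⟩
  · rintro ⟨p, rfl⟩; exact ⟨p, rfl⟩

theorem inducing (A : AlgebraicRing K) :
    Topology.IsInducing (fun x : A.Elt => pt x.1) := by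
  constructor
  show TopologicalSpace.induced _ (affineZariski K A.n) = _
  rw [affine_eq, induced_compose]
  rfl

theorem noeth (A : AlgebraicRing K) : TopologicalSpace.NoetherianSpace A.Elt :=
  (inducing A).noetherianSpace

theorem cont_poly (A : AlgebraicRing K) (F : A.Elt → A.Elt)
    (Q : Fin A.n → MvPolynomial (Fin A.n) K)
    (h : ∀ x i, (F x).1 i = MvPolynomial.eval x.1 (Q i)) : Continuous F := by
  rw [(inducing A).continuous_iff]
  have : (fun x : A.Elt => pt x.1) ∘ F =
      (PrimeSpectrum.comap (aeval Q : MvPolynomial (Fin A.n) K →ₐ[K] _).toRingHom) ∘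
        (fun x : A.Elt => pt x.1) := by
    funext x
    apply PrimeSpectrum.ext
    ext p
    show MvPolynomial.eval (F x).1 p = 0 ↔ MvPolynomial.eval x.1 (aeval Q p) = 0
    have : (F x).1 = fun i => MvPolynomial.eval x.1 (Q i) := funext (h x)
    rw [this, eval_aeval']
  rw [this]
  exact (PrimeSpectrum.continuous_comap _).comp (inducing A).continuous

theorem exists_eqs (A : AlgebraicRing K) (J : Set A.Elt) (hJ : IsClosed J) :
    ∃ S : Set (MvPolynomial (Fin A.n) K),
      ∀ x : A.Elt, x ∈ J ↔ ∀ p ∈ S, MvPolynomial.eval x.1 p = 0 := by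
  obtain ⟨T, hT, rfl⟩ := (inducing A).isClosed_iff.1 hJ
  obtain ⟨S, rfl⟩ := (PrimeSpectrum.isClosed_iff_zeroLocus _).1 hT
  exact ⟨S, fun x => Iff.rfl⟩

theorem chev [IsAlgClosed K] {σ : Type} [Finite σ] (n : ℕ)
    (Q : Fin n → MvPolynomial σ K) (S : Set (MvPolynomial σ K)) :
    ∃ D : PrimeSpectrum.ConstructibleSetData (MvPolynomial (Fin n) K), ∀ x : Fin n → K,
      pt x ∈ D.toSet ↔ ∃ y : σ → K, (∀ p ∈ S, MvPolynomial.eval y p = 0) ∧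
        ∀ i, x i = MvPolynomial.eval y (Q i) := by
  let φ : MvPolynomial (Fin n) K →+* MvPolynomial σ K :=
    (aeval Q : MvPolynomial (Fin n) K →ₐ[K] _).toRingHom
  have hφ : φ.FinitePresentation := by
    apply RingHom.FinitePresentation.of_finiteType.1
    apply RingHom.FiniteType.of_comp_finiteType (f := C)
    have : φ.comp C = algebraMap K _ := (aeval Q : MvPolynomial (Fin n) K →ₐ[K] _).comp_algebraMap
    rw [this, RingHom.finiteType_algebraMap]
    infer_instance
  have hc : Topology.IsConstructible (PrimeSpectrum.zeroLocus S) := by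
    rw [← Topology.isConstructible_compl]
    have ho : IsOpen (PrimeSpectrum.zeroLocus S)ᶜ :=
      (PrimeSpectrum.isClosed_zeroLocus S).isOpen_compl
    have hr : IsRetrocompact (PrimeSpectrum.zeroLocus S)ᶜ := fun U _ _ =>
      TopologicalSpace.NoetherianSpace.isCompact _
    exact hr.isConstructible ho
  obtain ⟨D, hD⟩ := PrimeSpectrum.exists_constructibleSetData_iff.2
    (PrimeSpectrum.isConstructible_comap_image hφ hc)
  refine ⟨D, fun x => ?_⟩
  rw [hD]
  have hev : ∀ (y : σ → K) p, MvPolynomial.eval y (φ p) =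
      MvPolynomial.eval (fun i => MvPolynomial.eval y (Q i)) p := by
    intro y p
    exact eval_aeval' Q y p
  constructor
  · rintro ⟨q, hq, hqx⟩
    let I := Ideal.span S ⊔ (pt x).asIdeal.map φ
    have hI : I ≤ q.asIdeal := by
      refine sup_le (Ideal.span_le.2 hq) (Ideal.map_le_iff_le_comap.2 ?_)
      rw [← hqx]; rfl
    obtain ⟨M, hM, hIM⟩ := Ideal.exists_le_maximal I
      (fun h => q.2.ne_top (top_le_iff.1 (h ▸ hI)))
    obtain ⟨y, rfl⟩ := MvPolynomial.isMaximal_iff_eq_vanishingIdeal_singleton.1 hM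
    have hy : ∀ p ∈ I, MvPolynomial.eval y p = 0 := by
      intro p hp
      simpa using (mem_vanishingIdeal_singleton_iff y p).1 (hIM hp)
    refine ⟨y, fun p hp => hy p (Ideal.mem_sup_left (Ideal.subset_span hp)), fun i => ?_⟩
    have h1 : (X i - C (x i) : MvPolynomial (Fin n) K) ∈ (pt x).asIdeal := by
      rw [mem_pt]; simp
    have h2 := hy _ (Ideal.mem_sup_right (Ideal.mem_map_of_mem φ h1))
    rw [hev] at h2
    simp at h2
    exact (sub_eq_zero.1 h2).symm
  · rintro ⟨y, hy, hxy⟩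
    refine ⟨pt y, hy, ?_⟩
    apply PrimeSpectrum.ext
    ext p
    show MvPolynomial.eval y (φ p) = 0 ↔ MvPolynomial.eval x p = 0
    rw [hev, show x = fun i => MvPolynomial.eval y (Q i) from funext hxy]

theorem cont_add (A : AlgebraicRing K) (c : A.Elt) : Continuous (fun x : A.Elt => x + c) := by
  obtain ⟨P, hP⟩ := A.add_poly
  refine cont_poly A _ (fun i => aeval (Sum.elim X (fun j => C (c.1 j))) (P i)) fun x i => ?_
  refine (hP x.1 c.1 i).trans ?_
  rw [eval_aeval']
  congr 2
  funext j
  cases j <;> simp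

theorem cont_mul (A : AlgebraicRing K) (c : A.Elt) : Continuous (fun x : A.Elt => x * c) := by
  obtain ⟨P, hP⟩ := A.mul_poly
  refine cont_poly A _ (fun i => aeval (Sum.elim X (fun j => C (c.1 j))) (P i)) fun x i => ?_
  refine (hP x.1 c.1 i).trans ?_
  rw [eval_aeval']
  congr 2
  funext j
  cases j <;> simp

theorem cont_neg (A : AlgebraicRing K) : Continuous (fun x : A.Elt => -x) := by
  obtain ⟨P, hP⟩ := A.neg_poly
  exact cont_poly A _ P fun x i => hP x.1 i

theorem closed_step [IsAlgClosed K] (A : CommAlgebraicRing K) (J : Ideal A.Elt)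
    (hJ : IsClosed (J : Set A.Elt)) (c : A.Elt) :
    IsClosed ((Ideal.span {c} ⊔ J : Ideal A.Elt) : Set A.Elt) := by
  obtain ⟨S₁, hS₁⟩ := A.carrier_closed
  obtain ⟨S₂, hS₂⟩ := exists_eqs A.toAlgebraicRing J hJ
  obtain ⟨P, hP⟩ := A.add_poly
  obtain ⟨M, hM⟩ := A.mul_poly
  let M' : Fin A.n → MvPolynomial (Fin A.n ⊕ Fin A.n) K := fun i =>
    aeval (Sum.elim (fun j => X (Sum.inl j)) (fun j => C (c.1 j))) (M i)
  let Q : Fin A.n → MvPolynomial (Fin A.n ⊕ Fin A.n) K := fun i =>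
    aeval (Sum.elim M' (fun j => X (Sum.inr j))) (P i)
  let S : Set (MvPolynomial (Fin A.n ⊕ Fin A.n) K) :=
    rename Sum.inl '' S₁ ∪ rename Sum.inr '' (S₁ ∪ S₂)
  obtain ⟨D, hD⟩ := chev A.n Q S
  have key : ∀ x : A.Elt, x ∈ Ideal.span {c} ⊔ J ↔ pt x.1 ∈ D.toSet := by
    intro x
    rw [hD]
    have hQ : ∀ (a b : Fin A.n → K) i, MvPolynomial.eval (Sum.elim a b) (Q i) =
        A.add (A.mul a c.1) b i := by
      intro a b i
      rw [hP, eval_aeval']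
      congr 2
      funext j
      cases j with
      | inr j => simp
      | inl j =>
        simp only [Sum.elim_inl, M']
        rw [hM, eval_aeval']
        congr 2
        funext j
        cases j <;> simp
    constructor
    · intro hx
      obtain ⟨u, hu, j, hj, rfl⟩ := Submodule.mem_sup.1 hx
      obtain ⟨a, rfl⟩ := Ideal.mem_span_singleton'.1 hu
      refine ⟨Sum.elim a.1 j.1, ?_, fun i => (hQ _ _ i).symm⟩
      have ha : ∀ p ∈ S₁, MvPolynomial.eval a.1 p = 0 := hS₁.subset a.2
      have hj1 : ∀ p ∈ S₁, MvPolynomial.eval j.1 p = 0 := hS₁.subset j.2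
      have hj2 := (hS₂ j).1 hj
      rintro _ (⟨p, hp, rfl⟩ | ⟨p, hp | hp, rfl⟩)
      · rw [eval_rename]; exact ha p hp
      · rw [eval_rename]; exact hj1 p hp
      · rw [eval_rename]; exact hj2 p hp
    · rintro ⟨y, hy, hxy⟩
      have ha : y ∘ Sum.inl ∈ A.carrier := by
        rw [hS₁]; intro p hp
        have := hy _ (Or.inl ⟨p, hp, rfl⟩)
        rwa [eval_rename] at this
      have hb : y ∘ Sum.inr ∈ A.carrier := by
        rw [hS₁]; intro p hp
        have := hy _ (Or.inr ⟨p, Or.inl hp, rfl⟩)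
        rwa [eval_rename] at this
      let a : A.Elt := ⟨_, ha⟩
      let b : A.Elt := ⟨_, hb⟩
      have hbJ : b ∈ J := by
        refine (hS₂ b).2 fun p hp => ?_
        have := hy _ (Or.inr ⟨p, Or.inr hp, rfl⟩)
        rwa [eval_rename] at this
      have hx : x = a * c + b := by
        apply Subtype.ext
        funext i
        rw [hxy, ← Sum.elim_comp_inl_inr y, hQ]
        rfl
      rw [hx]
      exact Submodule.mem_sup.2 ⟨_, Ideal.mem_span_singleton'.2 ⟨a, rfl⟩, b, hbJ, rfl⟩
  have hi := (inducing A.toAlgebraicRing).continuous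
  refine closed_subgroup (cont_add _) (cont_neg _)
    (Submodule.toAddSubgroup (Ideal.span {c} ⊔ J)) D
    (fun B => (fun x : A.Elt => pt x.1) ⁻¹' PrimeSpectrum.zeroLocus (Set.range B.g))
    (fun B => (fun x : A.Elt => pt x.1) ⁻¹' PrimeSpectrum.zeroLocus {B.f})
    (fun B => (PrimeSpectrum.isClosed_zeroLocus _).preimage hi)
    (fun B => (PrimeSpectrum.isClosed_zeroLocus _).preimage hi) ?_
  ext x
  refine (key x).trans ?_
  simp only [PrimeSpectrum.ConstructibleSetData.toSet,
    PrimeSpectrum.BasicConstructibleSetData.toSet, Set.mem_iUnion]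
  rfl

theorem closed_bot (A : CommAlgebraicRing K) :
    IsClosed ((⊥ : Ideal A.Elt) : Set A.Elt) := by
  have : ((⊥ : Ideal A.Elt) : Set A.Elt) = (fun x : A.Elt => pt x.1) ⁻¹'
      PrimeSpectrum.zeroLocus (Set.range fun i => X i - C ((0 : A.Elt).1 i)) := by
    ext x
    simp only [Submodule.bot_coe, Set.mem_singleton_iff, Set.mem_preimage,
      PrimeSpectrum.mem_zeroLocus, Set.range_subset_iff, SetLike.mem_coe, mem_pt]
    simp only [map_sub, eval_X, eval_C, sub_eq_zero]
    exact ⟨fun h i => by rw [h], fun h => Subtype.ext (funext h)⟩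
  rw [this]
  exact (PrimeSpectrum.isClosed_zeroLocus _).preimage (inducing A.toAlgebraicRing).continuous

theorem closed_span [IsAlgClosed K] (A : CommAlgebraicRing K) (s : Finset A.Elt) :
    IsClosed ((Ideal.span (s : Set A.Elt) : Ideal A.Elt) : Set A.Elt) := by
  classical
  induction s using Finset.induction_on with
  | empty => simpa using closed_bot A
  | insert a s _ ih =>
    rw [Finset.coe_insert, Ideal.span_insert]
    exact closed_step A _ ih a

/-- the identity component -/
noncomputable def comp0 (A : CommAlgebraicRing K) : Ideal A.Elt where
  carrier := connectedComponent (0 : A.Elt)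
  zero_mem' := mem_connectedComponent
  add_mem' := by
    intro a b ha hb
    have h := (cont_add A.toAlgebraicRing b).image_connectedComponent_subset 0
    have h2 := h ⟨a, ha, rfl⟩
    simp only [zero_add] at h2
    rwa [← connectedComponent_eq hb] at h2
  smul_mem' := by
    intro c x hx
    have h := (cont_mul A.toAlgebraicRing c).image_connectedComponent_subset 0
    have h2 := h ⟨x, hx, rfl⟩
    simp only [zero_mul] at h2
    rw [smul_eq_mul, mul_comm]
    exact h2

end S9

/-- If `f : R → A` is an abstract ring homomorphism from a commutative
noetherian ring into a commutative algebraic ring over an algebraically closed field and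
`f(R)` is Zariski-dense in `A`, then the connected component `A°` of `0` is finitely
generated as an ideal of `A`. -/
theorem stmt_9 (K : Type) [Field K] [IsAlgClosed K] (R : Type) [CommRing R]
    [IsNoetherianRing R] (A : CommAlgebraicRing K)
    (f : R →+* A.Elt) (hdense : Dense (Set.range f)) :
    ∃ s : Finset A.Elt,
      ((Ideal.span (s : Set A.Elt) : Ideal A.Elt) : Set A.Elt) =
        connectedComponent (0 : A.Elt) := by
  classical
  obtain ⟨t, ht⟩ := (isNoetherianRing_iff_ideal_fg R).1 inferInstance ((S9.comp0 A).comap f)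
  refine ⟨t.image f, ?_⟩
  have hmap : (Ideal.span ((t.image f : Finset A.Elt) : Set A.Elt) : Ideal A.Elt) =
      ((S9.comp0 A).comap f).map f := by
    rw [← ht, Finset.coe_image]
    exact (Ideal.map_span f _).symm
  have hcl := S9.closed_span A (t.image f)
  have := S9.noeth A.toAlgebraicRing
  apply subset_antisymm
  · rw [hmap]
    have h0 : ((S9.comp0 A).comap f).map f ≤ S9.comp0 A := Ideal.map_comap_le
    exact h0
  · have h1 := hdense.open_subset_closure_inter (S9.isOpen_component (0 : A.Elt))
    refine h1.trans (closure_minimal ?_ hcl)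
    rintro _ ⟨hx, r, rfl⟩
    rw [hmap]
    exact Ideal.mem_map_of_mem f hx
end
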